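/- For integers k ≥ 2, n ≥ 1, 1 ≤ M ≤ kn−1, 1 ≤ j ≤ n and 1 ≤ l ≤ k, the probability under P_{n,k} of the event A^{(n)}_{M,j,l} (that among the first M entries the value j appears exactly l times and no value greater than j appears) equals C(M,l)·(k)_l·(k(j−1))_{M−l} / (kn)_M, where any falling factorial (b)_a with a > b is interpreted as 0. -/

import Mathlib

open Finset Filter

open scoped Classical

/-- The sample space `Ω_{n,k}`: sequences of length `k*n` with values in `Fin n`
(the value `v : Fin n` encodes the rank `v+1`), in which each value appears exactly `k`
times; these are the permutations of the multiset `{1^k, 2^k, …, n^k}`. -/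
def multisetPerms (n k : ℕ) : Finset (Fin (k*n) → Fin n) :=
  Finset.univ.filter (fun w => ∀ v : Fin n, (Finset.univ.filter (fun i => w i = v)).card = k)

/-- The maximum (as a `0`-based value) among the first `M` entries of `w`. -/
def firstMax (n k M : ℕ) (w : Fin (k*n) → Fin n) : ℕ :=
  (Finset.univ.filter (fun t : Fin (k*n) => (t : ℕ) < M)).sup (fun t => (w t : ℕ))

/-- The strategy `S(n,k;M)` succeeds on `w`: there is an index `i` beyond the first `M`
entries whose value is `≥` the maximum of the first `M` entries, and the first such index
carries an item of the highest rank `n`. -/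
def succeedsS (n k M : ℕ) (w : Fin (k*n) → Fin n) : Prop :=
  ∃ i : Fin (k*n), M ≤ (i : ℕ) ∧ firstMax n k M w ≤ (w i : ℕ) ∧
    (∀ i' : Fin (k*n), M ≤ (i' : ℕ) → firstMax n k M w ≤ (w i' : ℕ) → i ≤ i') ∧
    (w i : ℕ) + 1 = n

/-- The strategy `S⁺(n,k;M)` succeeds on `w`: there is an index `i` beyond the first `M`
entries whose value is strictly greater than the maximum of the first `M` entries, and the
first such index carries an item of the highest rank `n`. -/
def succeedsSplus (n k M : ℕ) (w : Fin (k*n) → Fin n) : Prop :=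
  ∃ i : Fin (k*n), M ≤ (i : ℕ) ∧ firstMax n k M w < (w i : ℕ) ∧
    (∀ i' : Fin (k*n), M ≤ (i' : ℕ) → firstMax n k M w < (w i' : ℕ) → i ≤ i') ∧
    (w i : ℕ) + 1 = n

/-- `P_{n,k}(S(n,k;M))`: the probability of success of strategy `S(n,k;M)` under the
uniform measure on `Ω_{n,k}`. -/
noncomputable def probS (n k M : ℕ) : ℝ :=
  (((multisetPerms n k).filter (succeedsS n k M)).card : ℝ) / ((multisetPerms n k).card : ℝ)

/-- `P_{n,k}(S⁺(n,k;M))`: the probability of success of strategy `S⁺(n,k;M)` under the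
uniform measure on `Ω_{n,k}`. -/
noncomputable def probSplus (n k M : ℕ) : ℝ :=
  (((multisetPerms n k).filter (succeedsSplus n k M)).card : ℝ) / ((multisetPerms n k).card : ℝ)

/-- The event `A^{(n)}_{M,j,l}`: among the first `M` entries, the rank `j` appears exactly
`l` times and no rank greater than `j` appears. -/
def eventA (n k M j l : ℕ) (w : Fin (k*n) → Fin n) : Prop :=
  ((Finset.univ.filter (fun i : Fin (k*n) => (i : ℕ) < M ∧ (w i : ℕ) + 1 = j)).card = l) ∧
  ∀ i : Fin (k*n), (i : ℕ) < M → (w i : ℕ) + 1 ≤ j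

theorem multisetPerms_nonempty (n k : ℕ) : (multisetPerms n k).Nonempty := by
  refine ⟨fun i => (finProdFinEquiv.symm i).2, ?_⟩
  simp only [multisetPerms, mem_filter, mem_univ, true_and]
  intro v
  have h : (univ.filter fun i : Fin (k * n) => (finProdFinEquiv.symm i).2 = v)
      = (univ : Finset (Fin k)).image fun a => finProdFinEquiv (a, v) := by
    ext i
    simp only [mem_filter, mem_univ, true_and, mem_image]
    constructor
    · rintro rfl
      exact ⟨(finProdFinEquiv.symm i).1, finProdFinEquiv.apply_symm_apply i⟩
    · rintro ⟨a, rfl⟩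
      simp
  rw [h, card_image_of_injective _ fun a b hab => by simpa using hab, card_univ, Fintype.card_fin]

/-- Among the entries at the positions in `T`, the rank `j` appears exactly `l` times and no
rank greater than `j` appears. -/
def rankCountOn {N n : ℕ} (j l : ℕ) (w : Fin N → Fin n) (T : Finset (Fin N)) : Prop :=
  (T.filter fun i => (w i : ℕ) + 1 = j).card = l ∧ ∀ i ∈ T, (w i : ℕ) + 1 ≤ j

theorem eventA_iff_rankCountOn (n k M j l : ℕ) (w : Fin (k * n) → Fin n) :
    eventA n k M j l w ↔ rankCountOn j l w (univ.filter fun i => (i : ℕ) < M) := by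
  simp [eventA, rankCountOn, filter_filter]

theorem rankCountOn_map {N n : ℕ} (j l : ℕ) (w : Fin N → Fin n) (T : Finset (Fin N))
    (σ : Equiv.Perm (Fin N)) :
    rankCountOn j l w (T.map σ.toEmbedding) ↔ rankCountOn j l (w ∘ σ) T := by
  simp only [rankCountOn, filter_map, card_map, forall_mem_map]
  rfl

theorem comp_perm_mem_multisetPerms {n k : ℕ} {w : Fin (k * n) → Fin n}
    (hw : w ∈ multisetPerms n k) (σ : Equiv.Perm (Fin (k * n))) :
    w ∘ σ ∈ multisetPerms n k := by
  simp only [multisetPerms, mem_filter, mem_univ, true_and] at hw ⊢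
  intro v
  refine Eq.trans ?_ (hw v)
  rw [← card_map σ.toEmbedding]
  congr 1
  ext i
  simp

/-- The number of sequences with prescribed rank counts on a set of positions depends only on the
size of that set. -/
theorem card_filter_rankCountOn_eq {n k : ℕ} (j l : ℕ) {S T : Finset (Fin (k * n))}
    (h : S.card = T.card) :
    ((multisetPerms n k).filter fun w => rankCountOn j l w T).card
      = ((multisetPerms n k).filter fun w => rankCountOn j l w S).card := by
  have e : S ≃ T := Finset.equivOfCardEq h
  obtain ⟨σ, rfl⟩ : ∃ σ : Equiv.Perm (Fin (k * n)), S.map σ.toEmbedding = T := by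
    refine ⟨e.extendSubtype, eq_of_subset_of_card_le (fun x hx => ?_) (by simp [h])⟩
    obtain ⟨y, hy, rfl⟩ := mem_map.1 hx
    exact e.extendSubtype_mem y hy
  refine card_nbij' (fun w => w ∘ σ) (fun w => w ∘ σ.symm) ?_ ?_ ?_ ?_
  · intro w hw
    simp only [coe_filter, Set.mem_ofPred_eq, rankCountOn_map] at hw ⊢
    exact ⟨comp_perm_mem_multisetPerms hw.1 σ, hw.2⟩
  · intro w hw
    simp only [coe_filter, Set.mem_ofPred_eq, rankCountOn_map] at hw ⊢
    refine ⟨comp_perm_mem_multisetPerms hw.1 σ.symm, ?_⟩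
    simpa [Function.comp_assoc] using hw.2
  · intro w _
    simp [Function.comp_assoc]
  · intro w _
    simp [Function.comp_assoc]

theorem card_filter_rank_eq {n k j : ℕ} {w : Fin (k * n) → Fin n} (hw : w ∈ multisetPerms n k)
    (hj1 : 1 ≤ j) (hj2 : j ≤ n) :
    (univ.filter fun i => (w i : ℕ) + 1 = j).card = k := by
  simp only [multisetPerms, mem_filter, mem_univ, true_and] at hw
  refine Eq.trans ?_ (hw ⟨j - 1, by omega⟩)
  congr 1
  ext i
  simp only [mem_filter, mem_univ, true_and, Fin.ext_iff]
  omega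

theorem card_filter_rank_lt {n k j : ℕ} {w : Fin (k * n) → Fin n} (hw : w ∈ multisetPerms n k)
    (hj2 : j ≤ n) :
    (univ.filter fun i => (w i : ℕ) + 1 < j).card = k * (j - 1) := by
  rw [card_eq_sum_card_fiberwise (f := fun i => (w i : ℕ) + 1) (t := Ico 1 j)]
  · rw [sum_const_nat (m := k), Nat.card_Ico, mul_comm]
    intro r hr
    rw [mem_Ico] at hr
    rw [filter_filter]
    refine Eq.trans ?_ (card_filter_rank_eq hw hr.1 (hr.2.le.trans hj2))
    congr 1
    ext i
    simp only [mem_filter, mem_univ, true_and]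
    omega
  · intro i hi
    simpa using hi

theorem card_positions_rankCountOn {N n M j l : ℕ} (w : Fin N → Fin n) (hl : l ≤ M) :
    ((powersetCard M univ).filter fun T => rankCountOn j l w T).card
      = (univ.filter fun i => (w i : ℕ) + 1 = j).card.choose l
        * (univ.filter fun i => (w i : ℕ) + 1 < j).card.choose (M - l) := by
  rw [← card_powersetCard, ← card_powersetCard, ← card_product]
  refine card_nbij' (fun T => (T.filter fun i => (w i : ℕ) + 1 = j,
    T.filter fun i => ¬ (w i : ℕ) + 1 = j)) (fun p => p.1 ∪ p.2) ?_ ?_ ?_ ?_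
  · intro T hT
    simp only [mem_coe, mem_filter, mem_powersetCard] at hT
    obtain ⟨⟨-, hM⟩, hl', hle⟩ := hT
    have hsum := card_filter_add_card_filter_not (s := T) fun i => (w i : ℕ) + 1 = j
    simp only [mem_coe, mem_product, mem_powersetCard]
    refine ⟨⟨filter_subset_filter _ (subset_univ _), hl'⟩, fun i hi => ?_, by omega⟩
    simp only [mem_filter, mem_univ, true_and] at hi ⊢
    have := hle i hi.1
    omega
  · rintro ⟨B, L⟩ hp
    simp only [mem_coe, mem_product, mem_powersetCard] at hp
    obtain ⟨⟨hB, hBc⟩, hL, hLc⟩ := hp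
    have hB' : ∀ i ∈ B, (w i : ℕ) + 1 = j := fun i hi => (mem_filter.1 (hB hi)).2
    have hL' : ∀ i ∈ L, (w i : ℕ) + 1 < j := fun i hi => (mem_filter.1 (hL hi)).2
    have hd : Disjoint B L := disjoint_left.2 fun i hi hi' => (hL' i hi').ne (hB' i hi)
    simp only [mem_coe, mem_filter, mem_powersetCard]
    refine ⟨⟨subset_univ _, by rw [card_union_of_disjoint hd]; omega⟩, ?_, fun i hi => ?_⟩
    · rw [filter_union, filter_true_of_mem hB', filter_false_of_mem fun i hi => (hL' i hi).ne,
        union_empty, hBc]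
    · rcases mem_union.1 hi with hi | hi
      exacts [(hB' i hi).le, (hL' i hi).le]
  · intro T _
    exact filter_union_filter_not_eq _ _
  · rintro ⟨B, L⟩ hp
    simp only [mem_coe, mem_product, mem_powersetCard] at hp
    obtain ⟨⟨hB, -⟩, hL, -⟩ := hp
    have hB' : ∀ i ∈ B, (w i : ℕ) + 1 = j := fun i hi => (mem_filter.1 (hB hi)).2
    have hL' : ∀ i ∈ L, ¬ (w i : ℕ) + 1 = j := fun i hi => (mem_filter.1 (hL hi)).2.ne
    simp only [Prod.mk.injEq, filter_union]
    rw [filter_true_of_mem hB', filter_false_of_mem hL', filter_true_of_mem hL',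
      filter_false_of_mem fun i hi => not_not.2 (hB' i hi)]
    simp

/-- Double counting of the pairs of a sequence and an `M`-set of positions on which it has the
prescribed rank counts. -/
theorem choose_mul_card_eventA {n k M j l : ℕ} (hM : M ≤ k * n) (hj1 : 1 ≤ j) (hj2 : j ≤ n)
    (hl : l ≤ M) :
    (k * n).choose M * ((multisetPerms n k).filter (eventA n k M j l)).card
      = (multisetPerms n k).card * (k.choose l * (k * (j - 1)).choose (M - l)) := by
  have hI : (univ.filter fun i : Fin (k * n) => (i : ℕ) < M).card = M := by
    simp [Fin.card_filter_val_lt, hM]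
  have hA : (multisetPerms n k).filter (eventA n k M j l)
      = (multisetPerms n k).filter fun w =>
          rankCountOn j l w (univ.filter fun i => (i : ℕ) < M) :=
    filter_congr fun w _ => eventA_iff_rankCountOn n k M j l w
  have h : ∑ w ∈ multisetPerms n k,
        ((powersetCard M univ).filter fun T => rankCountOn j l w T).card
      = ∑ T ∈ powersetCard M univ,
        ((multisetPerms n k).filter fun w => rankCountOn j l w T).card :=
    sum_card_bipartiteAbove_eq_sum_card_bipartiteBelow (rankCountOn j l)
  rw [sum_const_nat fun w hw => (card_positions_rankCountOn w hl).trans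
      (by rw [card_filter_rank_eq hw hj1 hj2, card_filter_rank_lt hw hj2]),
    sum_const_nat fun T hT =>
      card_filter_rankCountOn_eq j l (hI.trans (mem_powersetCard.1 hT).2.symm),
    card_powersetCard, card_univ, Fintype.card_fin] at h
  rw [hA, h]

/-- Equation (2.1): the probability of the event `A^{(n)}_{M,j,l}`. -/
theorem secretary_multirank_eventA_prob (n k M j l : ℕ) (hk : 2 ≤ k) (hn : 1 ≤ n)
    (hM1 : 1 ≤ M) (hM2 : M ≤ k*n - 1) (hj1 : 1 ≤ j) (hj2 : j ≤ n)
    (hl1 : 1 ≤ l) (hl2 : l ≤ k) :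
    (((multisetPerms n k).filter (eventA n k M j l)).card : ℝ)
        / ((multisetPerms n k).card : ℝ)
      = ((M.choose l : ℝ) * (Nat.descFactorial k l : ℝ)
            * (Nat.descFactorial (k*(j-1)) (M-l) : ℝ))
          / (Nat.descFactorial (k*n) M : ℝ) := by
  by_cases hl : l ≤ M
  · have hM : M ≤ k * n := by omega
    have hΩ : ((multisetPerms n k).card : ℝ) ≠ 0 :=
      Nat.cast_ne_zero.2 (multisetPerms_nonempty n k).card_pos.ne'
    have hD : ((k * n).descFactorial M : ℝ) ≠ 0 :=
      Nat.cast_ne_zero.2 (Nat.pos_of_ne_zero (by simp [Nat.descFactorial_eq_zero_iff_lt, hM])).ne'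
    have h := choose_mul_card_eventA hM hj1 hj2 hl
    have hf := Nat.choose_mul_factorial_mul_factorial hl
    rw [div_eq_div_iff hΩ hD]
    norm_cast
    simp only [Nat.descFactorial_eq_factorial_mul_choose]
    rw [← hf]
    linear_combination M.choose l * l.factorial * (M - l).factorial * h
  · have hA : (multisetPerms n k).filter (eventA n k M j l) = ∅ := by
      refine filter_eq_empty_iff.2 fun w _ h => hl ?_
      rw [← h.1]
      refine (card_le_card fun i hi => ?_).trans
        (Fin.card_filter_val_lt.trans_le (min_le_right (k * n) M))
      simp only [mem_filter, mem_univ, true_and] at hi ⊢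
      exact hi.1
    simp [hA, Nat.choose_eq_zero_of_lt (not_le.1 hl)]
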